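/- arXiv:1404.2757 — 4 statements merged into one kernel-verified Lean document; each statement's English description precedes it below -/
import Mathlib

section
/- For all real numbers m and a and all nonnegative real numbers σ² and v, the measure obtained by binding the Gaussian measure gaussianReal m σ² with the kernel x ↦ gaussianReal (a·x) v equals gaussianReal (a·m) (a²·σ² + v). (This is the composition rule underlying the Mehler-type formula (5.5) for the Ornstein–Uhlenbeck transition probabilities p_t(x,dy) = N(e^{-tA}x, Q_t)(dy).) -/
open MeasureTheory ProbabilityTheory

theorem gaussianReal_bind_gaussianReal (m a : ℝ) (σ2 v : NNReal) :
    (gaussianReal m σ2).bind (fun x => gaussianReal (a * x) v) =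
      gaussianReal (a * m) ((a ^ 2).toNNReal * σ2 + v) := by
  have hκ : Measurable (fun x : ℝ => gaussianReal (a * x) v) :=
    measurable_gaussianReal.comp (by fun_prop : Measurable fun x : ℝ => (a * x, v))
  have hσ : (a ^ 2).toNNReal = .mk (a ^ 2) (sq_nonneg a) :=
    Real.toNNReal_of_nonneg (sq_nonneg a)
  have hconv : gaussianReal (a * m) ((a ^ 2).toNNReal * σ2 + v) =
      ((gaussianReal m σ2).map (a * ·)).conv (gaussianReal 0 v) := by
    rw [gaussianReal_map_const_mul, gaussianReal_conv_gaussianReal, add_zero, hσ]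
  rw [hconv]
  refine Measure.ext_of_lintegral _ fun f hf => ?_
  rw [Measure.lintegral_bind hκ.aemeasurable hf.aemeasurable, Measure.lintegral_conv hf,
    lintegral_map (Measurable.lintegral_prod_right' (f := fun p : ℝ × ℝ => f (p.1 + p.2))
      (by fun_prop)) (by fun_prop)]
  refine lintegral_congr fun x => ?_
  rw [← lintegral_map hf (measurable_const_add (a * x)), gaussianReal_map_const_add, zero_add]
end

section
/- Let λ > 0, t > 0 and m ≠ 0. Then binding gaussianReal m (1/(2λ)) with the kernel x ↦ gaussianReal (e^{-λt}·x) ((1 - e^{-2λt})/(2λ)) yields the measure gaussianReal (e^{-λt}·m) (1/(2λ)), which is not equal to gaussianReal m (1/(2λ)). (This is the one-dimensional content of the Second Example (5.18)–(5.20): the translated Gaussian measure μ = N(1, ½A₁^{-1}) is not invariant for the Ornstein–Uhlenbeck semigroup p_t^{(1)}, because the semigroup contracts the mean.) -/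
open MeasureTheory ProbabilityTheory

theorem measurable_gaussianReal_const_mul (c : ℝ) (w : NNReal) :
    Measurable (fun x : ℝ => gaussianReal (c * x) w) :=
  measurable_gaussianReal.comp (f := fun x : ℝ => (c * x, w)) (by fun_prop)

theorem gaussianReal_bind_gaussianReal_const_mul (m c : ℝ) (v w : NNReal) :
    (gaussianReal m v).bind (fun x => gaussianReal (c * x) w) =
      gaussianReal (c * m) (NNReal.mk (c ^ 2) (sq_nonneg c) * v + w) := by
  rw [← add_zero (c * m), ← gaussianReal_conv_gaussianReal, ← gaussianReal_map_const_mul]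
  ext s hs
  rw [Measure.bind_apply hs (measurable_gaussianReal_const_mul c w).aemeasurable,
    Measure.conv, Measure.map_apply measurable_add hs,
    Measure.prod_apply (measurable_add hs),
    lintegral_map (measurable_measure_prodMk_left (measurable_add hs)) (by fun_prop)]
  refine lintegral_congr fun x => ?_
  rw [← zero_add (c * x), ← gaussianReal_map_const_add, Measure.map_apply (by fun_prop) hs,
    zero_add]
  rfl

theorem ou_not_invariant_of_translated_mean (lam t m : ℝ) (hlam : 0 < lam) (ht : 0 < t)
    (hm : m ≠ 0) :
    (gaussianReal m ((1 / (2 * lam)).toNNReal)).bind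
        (fun x => gaussianReal (Real.exp (-lam * t) * x)
          (((1 - Real.exp (-2 * lam * t)) / (2 * lam)).toNNReal)) =
      gaussianReal (Real.exp (-lam * t) * m) ((1 / (2 * lam)).toNNReal) ∧
    gaussianReal (Real.exp (-lam * t) * m) ((1 / (2 * lam)).toNNReal) ≠
      gaussianReal m ((1 / (2 * lam)).toNNReal) := by
  have hpos : 0 < lam * t := mul_pos hlam ht
  constructor
  · rw [gaussianReal_bind_gaussianReal_const_mul]
    congr 1
    have hexp : Real.exp (-2 * lam * t) ≤ 1 := Real.exp_le_one_iff.mpr (by linarith)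
    have hsq : Real.exp (-lam * t) ^ 2 = Real.exp (-2 * lam * t) := by
      rw [← Real.exp_nat_mul]
      ring_nf
    apply NNReal.eq
    rw [NNReal.coe_add, NNReal.coe_mul, NNReal.coe_mk, hsq, Real.coe_toNNReal _ (by positivity),
      Real.coe_toNNReal _ (div_nonneg (by linarith) (by positivity))]
    ring
  · rw [Ne, gaussianReal_ext_iff, not_and_or, mul_eq_right₀ hm, Real.exp_eq_one_iff]
    left
    linarith
end

section
/- Let v > 0, a ∈ ℝ, and let f : ℝ → ℝ be bounded and measurable. Then the function x ↦ ∫ f(z) d(gaussianReal (a·x) v)(z) is continuous on ℝ. (This is the strong Feller property (5.9) of the Gaussian Mehler semigroups p_t^{(i)}, stated for a one-dimensional nondegenerate Gaussian kernel.) -/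
open MeasureTheory ProbabilityTheory

/-- Gaussian densities whose means lie within distance one of `m₀` are dominated by a single
integrable Gaussian of twice the variance. -/
theorem gaussianPDFReal_le_of_abs_sub_le_one {v : NNReal} {m m₀ : ℝ}
    (hm : |m - m₀| ≤ 1) (z : ℝ) :
    gaussianPDFReal m v z ≤
      (√(2 * Real.pi * v))⁻¹ * (Real.exp (1 / (2 * v)) *
        Real.exp (-(1 / (4 * v)) * (z - m₀) ^ 2)) := by
  simp only [gaussianPDFReal_def, ← Real.exp_add]
  gcongr
  have hsq : (m - m₀) ^ 2 ≤ 1 := (sq_le_one_iff_abs_le_one _).mpr hm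
  have key : (z - m₀) ^ 2 / 2 - 1 ≤ (z - m) ^ 2 := by
    nlinarith [sq_nonneg ((z - m) - (m - m₀))]
  calc -(z - m) ^ 2 / (2 * v) ≤ -((z - m₀) ^ 2 / 2 - 1) / (2 * v) := by gcongr
    _ = 1 / (2 * v) + -(1 / (4 * v)) * (z - m₀) ^ 2 := by ring

theorem continuous_integral_gaussianReal {v : NNReal} (hv : 0 < v) {f : ℝ → ℝ}
    (hf : Measurable f) {C : ℝ} (hfC : ∀ x, |f x| ≤ C) :
    Continuous (fun m : ℝ => ∫ z, f z ∂(gaussianReal m v)) := by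
  simp_rw [integral_gaussianReal_eq_integral_smul hv.ne', smul_eq_mul]
  refine continuous_iff_continuousAt.mpr fun m₀ => ?_
  refine continuousAt_of_dominated
    (bound := fun z => (√(2 * Real.pi * v))⁻¹ * (Real.exp (1 / (2 * v)) *
        Real.exp (-(1 / (4 * v)) * (z - m₀) ^ 2)) * C) ?_ ?_ ?_ ?_
  · exact .of_forall fun m => ((measurable_gaussianPDFReal m v).mul hf).aestronglyMeasurable
  · filter_upwards [Metric.closedBall_mem_nhds m₀ one_pos] with m hm
    refine .of_forall fun z => ?_
    rw [Metric.mem_closedBall, Real.dist_eq] at hm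
    rw [norm_mul, Real.norm_of_nonneg (gaussianPDFReal_nonneg m v z), Real.norm_eq_abs]
    exact mul_le_mul (gaussianPDFReal_le_of_abs_sub_le_one hm z) (hfC z) (abs_nonneg _)
      (by positivity)
  · have hb : (0 : ℝ) < 1 / (4 * v) := by positivity
    exact ((((integrable_exp_neg_mul_sq hb).comp_sub_right m₀).const_mul _).const_mul _).mul_const _
  · refine .of_forall fun z => Continuous.continuousAt ?_
    simp only [gaussianPDFReal_def]
    fun_prop

theorem gaussian_kernel_strong_feller (v : NNReal) (hv : 0 < v) (a : ℝ)
    (f : ℝ → ℝ) (hf : Measurable f) (C : ℝ) (hfC : ∀ x, |f x| ≤ C) :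
    Continuous (fun x : ℝ => ∫ z, f z ∂(gaussianReal (a * x) v)) :=
  (continuous_integral_gaussianReal hv hf hfC).comp (continuous_const_mul a)
end

section
/- Let λ > 0 and let u, v : ℝ → ℝ be twice continuously differentiable with compact support. Then ∫ (½u''(x) - λ·x·u'(x))·v(x) d(gaussianReal 0 (1/(2λ)))(x) = ∫ u(x)·(½v''(x) - λ·x·v'(x)) d(gaussianReal 0 (1/(2λ)))(x). (This is the one-dimensional model of the symmetry relation (5.13): the operator L is symmetric on test functions in L²(E;μ_i).) -/
open MeasureTheory ProbabilityTheory

theorem hasDerivAt_gaussianPDFReal (m : ℝ) (s : NNReal) (x : ℝ) :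
    HasDerivAt (gaussianPDFReal m s) (-((x - m) / s) * gaussianPDFReal m s x) x := by
  rw [gaussianPDFReal_def]
  have h : HasDerivAt (fun y : ℝ => -(y - m) ^ 2 / (2 * s)) (-((x - m) / s)) x := by
    refine (((((hasDerivAt_id x).sub_const m).pow 2).neg).div_const (2 * (s : ℝ))).congr_deriv ?_
    simp only [id_eq, Nat.cast_ofNat, Nat.add_one_sub_one, pow_one, mul_one]
    rw [neg_div, mul_div_mul_left _ _ two_ne_zero]
  refine (h.exp.const_mul _).congr_deriv ?_
  ring

theorem ou_generator_symmetric (lam : ℝ) (hlam : 0 < lam)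
    (u v : ℝ → ℝ) (hu : ContDiff ℝ 2 u) (husupp : HasCompactSupport u)
    (hv : ContDiff ℝ 2 v) (hvsupp : HasCompactSupport v) :
    ∫ x, ((1 / 2) * deriv (deriv u) x - lam * x * deriv u x) * v x
        ∂(gaussianReal 0 ((1 / (2 * lam)).toNNReal)) =
      ∫ x, u x * ((1 / 2) * deriv (deriv v) x - lam * x * deriv v x)
        ∂(gaussianReal 0 ((1 / (2 * lam)).toNNReal)) := by
  have hpos : 0 < 1 / (2 * lam) := by positivity
  have hs : (1 / (2 * lam)).toNNReal ≠ 0 := (Real.toNNReal_pos.2 hpos).ne'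
  rw [integral_gaussianReal_eq_integral_smul hs, integral_gaussianReal_eq_integral_smul hs]
  simp only [smul_eq_mul]
  set p := gaussianPDFReal 0 (1 / (2 * lam)).toNNReal
  have hp : ∀ x, HasDerivAt p (-(2 * lam * x) * p x) x := fun x => by
    refine (hasDerivAt_gaussianPDFReal 0 (1 / (2 * lam)).toNNReal x).congr_deriv ?_
    rw [Real.coe_toNNReal _ hpos.le, sub_zero, div_div_eq_mul_div, div_one, mul_comm x]
  have hpc : Continuous p := continuous_iff_continuousAt.2 fun x => (hp x).continuousAt
  have hu' : ContDiff ℝ 1 (deriv u) := hu.deriv' (n := 1)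
  have hv' : ContDiff ℝ 1 (deriv v) := hv.deriv' (n := 1)
  have hu1 : ∀ x, HasDerivAt u (deriv u x) x := fun x =>
    (hu.differentiable (by norm_num) x).hasDerivAt
  have hv1 : ∀ x, HasDerivAt v (deriv v x) x := fun x =>
    (hv.differentiable (by norm_num) x).hasDerivAt
  have hu2 : ∀ x, HasDerivAt (deriv u) (deriv (deriv u) x) x := fun x =>
    (hu'.differentiable (by norm_num) x).hasDerivAt
  have hv2 : ∀ x, HasDerivAt (deriv v) (deriv (deriv v) x) x := fun x =>
    (hv'.differentiable (by norm_num) x).hasDerivAt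
  have cu := hu.continuous
  have cv := hv.continuous
  have cu1 := hu'.continuous
  have cv1 := hv'.continuous
  have cu2 : Continuous (deriv (deriv u)) := hu'.continuous_deriv le_rfl
  have cv2 : Continuous (deriv (deriv v)) := hv'.continuous_deriv le_rfl
  have integrable_mul : ∀ {f g : ℝ → ℝ}, Continuous f → Continuous g → HasCompactSupport g →
      Integrable fun x => f x * g x := fun hf hg hgs =>
    (hf.mul hg).integrable_of_hasCompactSupport hgs.mul_left
  have int_left : Integrable fun x =>
      p x * (((1 / 2) * deriv (deriv u) x - lam * x * deriv u x) * v x) := by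
    simpa only [mul_assoc] using integrable_mul
      (f := fun x => p x * ((1 / 2) * deriv (deriv u) x - lam * x * deriv u x))
      (by fun_prop) cv hvsupp
  have int_right : Integrable fun x =>
      p x * (u x * ((1 / 2) * deriv (deriv v) x - lam * x * deriv v x)) := by
    refine (integrable_mul
      (f := fun x => p x * ((1 / 2) * deriv (deriv v) x - lam * x * deriv v x))
      (by fun_prop) cu husupp).congr (.of_forall fun x => ?_)
    ring
  have int_wronskian : Integrable fun x =>
      (1 / 2) * ((deriv u x * v x - u x * deriv v x) * p x) := by
    refine ((integrable_mul (f := fun x => (1 / 2) * p x * deriv u x)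
      (by fun_prop) cv hvsupp).sub (integrable_mul (f := fun x => (1 / 2) * p x * deriv v x)
      (by fun_prop) cu husupp)).congr (.of_forall fun x => ?_)
    simp only [Pi.sub_apply]
    ring
  rw [← sub_eq_zero, ← integral_sub int_left int_right]
  refine integral_eq_zero_of_hasDerivAt_of_integrable (fun x => ?_)
    (int_left.sub int_right) int_wronskian
  refine (((((hu2 x).mul (hv1 x)).sub ((hu1 x).mul (hv2 x))).mul (hp x)).const_mul
    (1 / 2 : ℝ)).congr_deriv ?_
  simp only [Pi.sub_apply, Pi.mul_apply]
  ring
end
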